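/- Let (b_j)_{j≥0} be real kernels with b₀ ≠ 0, let (θ_j)_{j≥0} be the associated DOC kernels, and suppose there is a constant m₁ > 0 such that for every m ≥ 1 and all real v₁, …, v_m: 2·∑_{ℓ=1}^{m} v_ℓ · ∑_{j=1}^{ℓ} b_{ℓ−j} v_j ≥ m₁·∑_{ℓ=1}^{m} v_ℓ². Then for every ε > 0, every m ≥ 1, and all real sequences v₁, …, v_m and w₁, …, w_m, the Young-type convolution inequality holds: ∑_{ℓ=1}^{m} ∑_{j=1}^{ℓ} θ_{ℓ−j} v_j w_ℓ ≤ ε·∑_{ℓ=1}^{m} ∑_{j=1}^{ℓ} θ_{ℓ−j} v_j v_ℓ + (1/(2 m₁ ε))·∑_{ℓ=1}^{m} w_ℓ². -/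

import Mathlib

/-- The DOC kernels associated with kernels `b`:
`θ₀ = 1/b₀` and `θ_j = -(1/b₀) * ∑_{s=1}^{j} θ_{j-s} b_s` for `j ≥ 1`. -/
noncomputable def doc (b : ℕ → ℝ) : ℕ → ℝ
  | 0 => 1 / b 0
  | j+1 => -(1 / b 0) * ∑ s ∈ (Finset.Icc 1 (j+1)).attach, doc b ((j+1) - s.1) * b s.1
  decreasing_by
    have h := Finset.mem_Icc.mp s.2
    omega

open PowerSeries in
lemma sum_Icc_conv_eq_coeff (a x : ℕ → ℝ) (n : ℕ) :
    ∑ j ∈ Finset.Icc 1 (n + 1), a (n + 1 - j) * x j =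
      coeff n (mk a * mk fun k => x (k + 1)) := by
  rw [mul_comm, coeff_mul, Finset.Nat.sum_antidiagonal_eq_sum_range_succ_mk,
    Finset.range_eq_Ico, ← Finset.Ico_add_one_right_eq_Icc, Finset.sum_Ico_eq_sum_range,
    Finset.sum_Ico_eq_sum_range]
  refine Finset.sum_congr (by simp) fun k _ => ?_
  simp [mul_comm, Nat.add_comm 1 k]

lemma doc_succ (b : ℕ → ℝ) (n : ℕ) :
    doc b (n + 1) =
      -(1 / b 0) * ∑ s ∈ Finset.Icc 1 (n + 1), doc b (n + 1 - s) * b s := by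
  rw [doc, Finset.sum_attach (Finset.Icc 1 (n + 1)) fun s => doc b (n + 1 - s) * b s]

open PowerSeries in
lemma mk_mul_mk_doc (b : ℕ → ℝ) (hb : b 0 ≠ 0) : mk b * mk (doc b) = 1 := by
  ext n
  cases n with
  | zero => simp [coeff_mul, doc, hb]
  | succ n =>
    have h := doc_succ b n
    rw [sum_Icc_conv_eq_coeff, mul_comm (mk (doc b)), coeff_mul] at h
    rw [coeff_mul, Finset.Nat.sum_antidiagonal_succ, coeff_one, if_neg n.succ_ne_zero]
    simp only [coeff_mk] at h ⊢
    rw [h]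
    field_simp
    ring

/-- Convolution with `doc b` is a right inverse of convolution with `b`. -/
lemma sum_conv_sum_conv_doc (b : ℕ → ℝ) (hb : b 0 ≠ 0) (v : ℕ → ℝ) {ℓ : ℕ} (hl : 1 ≤ ℓ) :
    ∑ j ∈ Finset.Icc 1 ℓ, b (ℓ - j) * ∑ i ∈ Finset.Icc 1 j, doc b (j - i) * v i = v ℓ := by
  obtain ⟨n, rfl⟩ := Nat.exists_eq_add_of_le' hl
  rw [sum_Icc_conv_eq_coeff b fun j => ∑ i ∈ Finset.Icc 1 j, doc b (j - i) * v i]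
  have h : (PowerSeries.mk fun k => ∑ i ∈ Finset.Icc 1 (k + 1), doc b (k + 1 - i) * v i) =
      PowerSeries.mk (doc b) * PowerSeries.mk fun k => v (k + 1) := by
    ext k
    rw [PowerSeries.coeff_mk, sum_Icc_conv_eq_coeff]
  rw [h, ← mul_assoc, mk_mul_mk_doc b hb, one_mul, PowerSeries.coeff_mk]

theorem doc_young_type_inequality (b : ℕ → ℝ) (hb : b 0 ≠ 0) (m1 : ℝ) (hm1 : 0 < m1)
    (hpd : ∀ m : ℕ, 1 ≤ m → ∀ v : ℕ → ℝ,
      m1 * ∑ ℓ ∈ Finset.Icc 1 m, (v ℓ)^2 ≤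
        2 * ∑ ℓ ∈ Finset.Icc 1 m, v ℓ * ∑ j ∈ Finset.Icc 1 ℓ, b (ℓ - j) * v j)
    (ε : ℝ) (hε : 0 < ε) (m : ℕ) (hm : 1 ≤ m) (v w : ℕ → ℝ) :
    ∑ ℓ ∈ Finset.Icc 1 m, ∑ j ∈ Finset.Icc 1 ℓ, doc b (ℓ - j) * v j * w ℓ ≤
      ε * ∑ ℓ ∈ Finset.Icc 1 m, ∑ j ∈ Finset.Icc 1 ℓ, doc b (ℓ - j) * v j * v ℓ
        + 1 / (2 * m1 * ε) * ∑ ℓ ∈ Finset.Icc 1 m, (w ℓ)^2 := by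
  set u : ℕ → ℝ := fun ℓ => ∑ j ∈ Finset.Icc 1 ℓ, doc b (ℓ - j) * v j with hu
  have hpos : m1 * ∑ ℓ ∈ Finset.Icc 1 m, (u ℓ) ^ 2 ≤ 2 * ∑ ℓ ∈ Finset.Icc 1 m, u ℓ * v ℓ := by
    refine (hpd m hm u).trans_eq ?_
    congr 1
    refine Finset.sum_congr rfl fun ℓ hl => ?_
    rw [hu, sum_conv_sum_conv_doc b hb v (Finset.mem_Icc.mp hl).1]
  have hyoung : ∑ ℓ ∈ Finset.Icc 1 m, u ℓ * w ℓ ≤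
      ε * m1 / 2 * ∑ ℓ ∈ Finset.Icc 1 m, (u ℓ) ^ 2
        + 1 / (2 * m1 * ε) * ∑ ℓ ∈ Finset.Icc 1 m, (w ℓ) ^ 2 := by
    rw [Finset.mul_sum, Finset.mul_sum, ← Finset.sum_add_distrib]
    refine Finset.sum_le_sum fun ℓ _ => ?_
    have h : ε * m1 / 2 * u ℓ ^ 2 + 1 / (2 * m1 * ε) * w ℓ ^ 2 - u ℓ * w ℓ =
        (ε * m1 * u ℓ - w ℓ) ^ 2 / (2 * m1 * ε) := by
      field_simp
      ring
    have h_nonneg : 0 ≤ (ε * m1 * u ℓ - w ℓ) ^ 2 / (2 * m1 * ε) := by positivity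
    linarith
  simp only [← Finset.sum_mul]
  linarith [mul_le_mul_of_nonneg_left hpos hε.le]
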